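/- arXiv:1907.02450 — 13 statements merged into one kernel-verified Lean document; each statement's English description precedes it below -/
import Mathlib

section
/- Let (X,d) be a metric space and f : X → X a continuous map. Then f has positive 𝒯₀-inverse shadowing if and only if: for every ε > 0 there exists δ > 0 such that for every x ∈ X there exists y ∈ X such that for every positive δ-method φ ∈ 𝒯₀(f,δ) and every k ∈ ω, d(f^k(x), φ(y)_k) < ε. -/
variable {X : Type*} [MetricSpace X]

/-- `φ` is a positive `δ`-method for `f`: for each `x`, `φ x` is a positive
`δ`-pseudo-orbit with `φ x 0 = x`. -/
def IsPosMethod (f : X → X) (δ : ℝ) (φ : X → ℕ → X) : Prop :=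
  ∀ x : X, φ x 0 = x ∧ ∀ k : ℕ, dist (f (φ x k)) (φ x (k + 1)) < δ

/-- `f` has positive `𝒯₀`-inverse shadowing. -/
def PosInverseShadowing (f : X → X) : Prop :=
  ∀ ε > (0 : ℝ), ∃ δ > (0 : ℝ), ∀ x : X, ∀ φ : X → ℕ → X, IsPosMethod f δ φ →
    ∃ y : X, ∀ k : ℕ, dist (φ y k) (f^[k] x) < ε

theorem stmt_0 (f : X → X) (hf : Continuous f) :
    PosInverseShadowing f ↔
      ∀ ε > (0 : ℝ), ∃ δ > (0 : ℝ), ∀ x : X, ∃ y : X,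
        ∀ φ : X → ℕ → X, IsPosMethod f δ φ →
          ∀ k : ℕ, dist (f^[k] x) (φ y k) < ε := by
  constructor
  · intro h ε hε
    obtain ⟨δ, hδ, h⟩ := h ε hε
    refine ⟨δ, hδ, fun x => ?_⟩
    by_contra! hbad
    choose φ hφ k hk using hbad
    obtain ⟨y, hy⟩ := h x (fun y => φ y y) fun y => hφ y y
    exact absurd (hy (k y)) (not_lt.mpr (dist_comm (f^[k y] x) _ ▸ hk y))
  · intro h ε hε
    obtain ⟨δ, hδ, h⟩ := h ε hε
    refine ⟨δ, hδ, fun x φ hφ => ?_⟩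
    obtain ⟨y, hy⟩ := h x
    exact ⟨y, fun k => dist_comm (f^[k] x) _ ▸ hy φ hφ k⟩
end

section
/- Let (X,d) be a metric space and f : X → X a homeomorphism. Then f has 𝒯₀-inverse shadowing if and only if: for every ε > 0 there exists δ > 0 such that for every x ∈ X there exists y ∈ X such that for every δ-method φ ∈ 𝒯₀(f,δ) and every k ∈ ℤ, d(f^k(x), φ(y)_k) < ε. -/
variable {X : Type*} [MetricSpace X]

/-- `φ` is a `δ`-method for the homeomorphism `f`: for each `x`, `φ x` is a
bi-infinite `δ`-pseudo-orbit with `φ x 0 = x`. -/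
def IsMethod (f : X ≃ X) (δ : ℝ) (φ : X → ℤ → X) : Prop :=
  ∀ x : X, φ x 0 = x ∧ ∀ k : ℤ, dist (f (φ x k)) (φ x (k + 1)) < δ

/-- `f` has `𝒯₀`-inverse shadowing. -/
def InverseShadowing (f : X ≃ X) : Prop :=
  ∀ ε > (0 : ℝ), ∃ δ > (0 : ℝ), ∀ x : X, ∀ φ : X → ℤ → X, IsMethod f δ φ →
    ∃ y : X, ∀ k : ℤ, dist (φ y k) ((f ^ k) x) < ε

theorem stmt_1 (f : X ≃ X) (hf : Continuous f) (hf' : Continuous f.symm) :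
    InverseShadowing f ↔
      ∀ ε > (0 : ℝ), ∃ δ > (0 : ℝ), ∀ x : X, ∃ y : X,
        ∀ φ : X → ℤ → X, IsMethod f δ φ →
          ∀ k : ℤ, dist ((f ^ k) x) (φ y k) < ε := by
  constructor
  · intro h ε hε
    obtain ⟨δ, hδ, H⟩ := h ε hε
    refine ⟨δ, hδ, fun x => ?_⟩
    by_contra! hbad
    choose φ hφ k hk using hbad
    obtain ⟨y, hy⟩ := H x (fun y => φ y y) fun y => hφ y y
    exact absurd (hy (k y)) (not_lt.2 (dist_comm ((f ^ k y) x) _ ▸ hk y))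
  · intro h ε hε
    obtain ⟨δ, hδ, H⟩ := h ε hε
    refine ⟨δ, hδ, fun x φ hφ => ?_⟩
    obtain ⟨y, hy⟩ := H x
    exact ⟨y, fun k => dist_comm ((f ^ k) x) _ ▸ hy φ hφ k⟩
end

section
/- Let (X,d) be a compact metric space and f : X → X a continuous map. Then f has positive 𝒯₀-inverse shadowing if and only if: for every ε > 0 there exists δ > 0 such that for every x ∈ X there exists y ∈ X such that for every positive δ-method φ ∈ 𝒯₀(f,δ), every k ∈ ω, and every z ∈ X with d(y,z) < δ, d(f^k(x), φ(z)_k) < ε. -/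
variable {X : Type*} [MetricSpace X]

theorem stmt_2 [CompactSpace X] (f : X → X) (hf : Continuous f) :
    PosInverseShadowing f ↔
      ∀ ε > (0 : ℝ), ∃ δ > (0 : ℝ), ∀ x : X, ∃ y : X,
        ∀ φ : X → ℕ → X, IsPosMethod f δ φ →
          ∀ k : ℕ, ∀ z : X, dist y z < δ → dist (f^[k] x) (φ z k) < ε := by
  constructor
  · intro h ε hε
    obtain ⟨δ₁, hδ₁, h⟩ := h (ε / 2) (half_pos hε)
    obtain ⟨η, hη, hfη⟩ := Metric.uniformContinuous_iff.1
      (CompactSpace.uniformContinuous_of_continuous hf) (δ₁ / 2) (half_pos hδ₁)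
    obtain ⟨δ, hδ, hlt⟩ := exists_between (lt_min (half_pos hε) (lt_min (half_pos hδ₁) hη))
    obtain ⟨hδε, hδδ₁, hδη⟩ : δ < ε / 2 ∧ δ < δ₁ / 2 ∧ δ < η := by simpa using hlt
    refine ⟨δ, hδ, ?_⟩
    by_contra! hbad
    obtain ⟨x, hx⟩ := hbad
    choose φ hφ k z hz hfar using hx
    -- Replace the initial point of the bad pseudo-orbit through `z y` by `y`.
    let ψ : X → ℕ → X := fun y n => n.casesOn y fun m => φ y (z y) (m + 1)
    have hψ : IsPosMethod f δ₁ ψ := by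
      refine fun y => ⟨rfl, fun n => ?_⟩
      have hstep := (hφ y (z y)).2 n
      cases n with
      | zero =>
        rw [(hφ y (z y)).1] at hstep
        change dist (f y) (φ y (z y) 1) < δ₁
        have hyz := hfη ((hz y).trans hδη)
        have := dist_triangle (f y) (f (z y)) (φ y (z y) 1)
        simp only [zero_add] at hstep
        linarith
      | succ n => exact hstep.trans (by linarith)
    obtain ⟨y, hy⟩ := h x ψ hψ
    have hyk := hy (k y)
    have hfar := hfar y
    cases hk : k y with
    | zero =>
      rw [hk] at hyk hfar
      rw [(hφ y (z y)).1] at hfar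
      change dist y x < ε / 2 at hyk
      change ε ≤ dist x (z y) at hfar
      have := dist_triangle_left x (z y) y
      linarith [hz y]
    | succ n =>
      rw [hk] at hyk hfar
      change dist (φ y (z y) (n + 1)) _ < ε / 2 at hyk
      rw [dist_comm] at hyk
      linarith
  · intro h ε hε
    obtain ⟨δ, hδ, h⟩ := h ε hε
    refine ⟨δ, hδ, fun x φ hφ => ?_⟩
    obtain ⟨y, hy⟩ := h x
    refine ⟨y, fun k => ?_⟩
    rw [dist_comm]
    exact hy φ hφ k y (by rwa [dist_self])
end

section
/- Let (X,d) be a compact metric space and f : X → X a homeomorphism. Then f has 𝒯₀-inverse shadowing if and only if: for every ε > 0 there exists δ > 0 such that for every x ∈ X there exists y ∈ X such that for every δ-method φ ∈ 𝒯₀(f,δ), every k ∈ ℤ, and every z ∈ X with d(y,z) < δ, d(f^k(x), φ(z)_k) < ε. -/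
variable {X : Type*} [MetricSpace X]

theorem stmt_3 [CompactSpace X] (f : X ≃ X) (hf : Continuous f)
    (hf' : Continuous f.symm) :
    InverseShadowing f ↔
      ∀ ε > (0 : ℝ), ∃ δ > (0 : ℝ), ∀ x : X, ∃ y : X,
        ∀ φ : X → ℤ → X, IsMethod f δ φ →
          ∀ k : ℤ, ∀ z : X, dist y z < δ → dist ((f ^ k) x) (φ z k) < ε := by
  constructor
  · intro h ε hε
    obtain ⟨δ₀, hδ₀, H⟩ := h (ε / 2) (half_pos hε)
    obtain ⟨η, hη, hfη⟩ := Metric.uniformContinuous_iff.1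
      (CompactSpace.uniformContinuous_of_continuous hf) (δ₀ / 2) (half_pos hδ₀)
    refine ⟨min (min (δ₀ / 2) η) (ε / 2), by positivity, fun x => ?_⟩
    by_contra! hbad
    choose φ hφ k z hz hfar using hbad
    simp only [lt_min_iff] at hz
    have hstep : ∀ y n, dist (f (φ y (z y) n)) (φ y (z y) (n + 1)) < δ₀ / 2 := fun y n =>
      (((hφ y (z y)).2 n).trans_le (min_le_left _ _)).trans_le (min_le_left _ _)
    -- Moving the time-zero entry of each bad pseudo-orbit to `y` gives a `δ₀`-method.
    obtain ⟨y, hy⟩ := H x (fun y n => if n = 0 then y else φ y (z y) n) <| by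
      refine fun y => ⟨if_pos rfl, fun n => ?_⟩
      have hn := hstep y n
      have h0 := (hφ y (z y)).1
      by_cases h1 : n = 0
      · subst h1
        rw [h0] at hn
        have hyz := hfη (hz y).1.2
        have htri := dist_triangle (f y) (f (z y)) (φ y (z y) (0 + 1))
        simp only [zero_add, one_ne_zero, if_true, if_false] at hn htri ⊢
        linarith
      · by_cases h2 : n + 1 = 0
        · rw [h2, h0] at hn
          have htri := dist_triangle (f (φ y (z y) n)) (z y) y
          have hyz := (hz y).1.1
          rw [dist_comm] at hyz
          simp only [h1, h2, if_true, if_false]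
          linarith
        · simp only [h1, h2, if_false]
          linarith
    have hyk := hy (k y)
    have hf_far := hfar y
    by_cases hk : k y = 0
    · rw [hk, (hφ y (z y)).1] at hf_far
      rw [hk, if_pos rfl, dist_comm] at hyk
      have htri := dist_triangle ((f ^ (0 : ℤ)) x) y (z y)
      have hyz := (hz y).2
      linarith
    · rw [if_neg hk, dist_comm] at hyk
      linarith
  · intro h ε hε
    obtain ⟨δ, hδ, H⟩ := h ε hε
    refine ⟨δ, hδ, fun x φ hφ => ?_⟩
    obtain ⟨y, hy⟩ := H x
    refine ⟨y, fun k => ?_⟩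
    rw [dist_comm]
    exact hy φ hφ k y (by rwa [dist_self])
end

section
/- Let (X,d) be a metric space and f : X → X a chain transitive continuous map. If f has positive weak inverse shadowing with respect to the class 𝒯₀, then f is minimal, i.e., the closure of the forward orbit of every point equals X. -/
variable {X : Type*} [MetricSpace X]

/-- `f` has positive weak inverse shadowing with respect to the class `𝒯₀`. -/
def PosWeakInverseShadowing (f : X → X) : Prop :=
  ∀ ε > (0 : ℝ), ∃ δ > (0 : ℝ), ∀ x : X, ∀ φ : X → ℕ → X, IsPosMethod f δ φ →
    ∃ y : X, ∀ k : ℕ, ∃ i : ℕ, dist (φ y k) (f^[i] x) < ε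

/-- `f` is chain transitive: between any two points and for any `δ > 0` there is a
finite `δ`-chain. -/
def ChainTransitive (f : X → X) : Prop :=
  ∀ a b : X, ∀ δ > (0 : ℝ), ∃ m : ℕ, 1 ≤ m ∧ ∃ z : ℕ → X, z 0 = a ∧ z m = b ∧
    ∀ i < m, dist (f (z i)) (z (i + 1)) < δ

/-- A `δ`-chain from `a` to `b` extends to a `δ`-pseudo-orbit by following the orbit of `b`. -/
theorem ChainTransitive.exists_pseudoOrbit {f : X → X} (hct : ChainTransitive f)
    {δ : ℝ} (hδ : 0 < δ) (a b : X) :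
    ∃ z : ℕ → X, (z 0 = a ∧ ∀ k, dist (f (z k)) (z (k + 1)) < δ) ∧ ∃ m, z m = b := by
  obtain ⟨m, -, z, h0, hm, hz⟩ := hct a b δ hδ
  refine ⟨fun k => if k ≤ m then z k else f^[k - m] b, ⟨by simpa using h0, fun k => ?_⟩,
    m, by simpa using hm⟩
  rcases lt_trichotomy k m with hk | rfl | hk
  · simpa [hk.le, Nat.succ_le_of_lt hk] using hz k hk
  · simpa [hm] using hδ
  · have hsub : k + 1 - m = (k - m) + 1 := by omega
    have hk' : ¬ k + 1 ≤ m := by omega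
    simpa [hk.not_ge, hk', hsub, Function.iterate_succ_apply'] using hδ

theorem stmt_9 (f : X → X) (hf : Continuous f) (hct : ChainTransitive f)
    (h : PosWeakInverseShadowing f) :
    ∀ x : X, closure (Set.range fun i : ℕ => f^[i] x) = Set.univ := by
  intro x
  refine Set.eq_univ_of_forall fun b => Metric.mem_closure_range_iff.2 fun ε hε => ?_
  obtain ⟨δ, hδ, hshadow⟩ := h ε hε
  choose φ hφ hit using fun a => hct.exists_pseudoOrbit hδ a b
  obtain ⟨y, hy⟩ := hshadow x φ hφ
  obtain ⟨m, hm⟩ := hit y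
  simpa only [hm] using hy m
end

section
/- Let (X,d) be a metric space and f : X → X a chain transitive continuous map. If f has the positive 𝒯₀-inverse shadowing property, then the system (X,f) is equicontinuous. -/
variable {X : Type*} [MetricSpace X]

/-- The system `(X, g)` is equicontinuous. -/
def EquicontinuousSystem (g : X → X) : Prop :=
  ∀ x : X, ∀ ε > (0 : ℝ), ∃ η > (0 : ℝ), ∀ y : X, dist x y < η →
    ∀ n : ℕ, dist (g^[n] x) (g^[n] y) < ε

/-- `ξ` is a positive `δ`-pseudo-orbit of `f`. -/
def IsPosPseudoOrbit (f : X → X) (δ : ℝ) (ξ : ℕ → X) : Prop :=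
  ∀ k : ℕ, dist (f (ξ k)) (ξ (k + 1)) < δ

/-- Concatenating a finite `δ`-chain ending at `ξ 0` with the pseudo-orbit `ξ` gives a
pseudo-orbit. -/
theorem IsPosPseudoOrbit.concat {f : X → X} {δ : ℝ} {ξ z : ℕ → X} {m : ℕ}
    (hξ : IsPosPseudoOrbit f δ ξ)
    (hz : ∀ i, i + 1 < m → dist (f (z i)) (z (i + 1)) < δ)
    (hlast : ∀ i, i + 1 = m → dist (f (z i)) (ξ 0) < δ) :
    IsPosPseudoOrbit f δ (fun k => if k < m then z k else ξ (k - m)) := by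
  intro k
  rcases lt_trichotomy (k + 1) m with hk | hk | hk
  · simpa [hk, (Nat.lt_succ_self k).trans hk] using hz k hk
  · subst hk
    simpa using hlast k rfl
  · have h1 : ¬ k < m := by omega
    have h2 : ¬ k + 1 < m := by omega
    have h3 : k + 1 - m = k - m + 1 := by omega
    simpa only [h1, h2, h3, if_false] using hξ (k - m)

theorem isPosPseudoOrbit_iterate (f : X → X) {δ : ℝ} (hδ : 0 < δ) (x : X) :
    IsPosPseudoOrbit f δ (fun k => f^[k] x) := fun k => by
  simpa [Function.iterate_succ_apply'] using hδ

/-- Repeating a closed `δ`-chain gives a pseudo-orbit. -/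
theorem isPosPseudoOrbit_periodic {f : X → X} {δ : ℝ} {w : ℕ → X} {L : ℕ} (hL : 1 ≤ L)
    (hclosed : w L = w 0) (hw : ∀ i < L, dist (f (w i)) (w (i + 1)) < δ) :
    IsPosPseudoOrbit f δ (fun k => w (k % L)) := by
  intro k
  have hk := Nat.mod_lt k hL
  have h1 := hw _ hk
  have h2 : (k + 1) % L = (k % L + 1) % L := by simp
  show dist (f (w (k % L))) (w ((k + 1) % L)) < δ
  rcases Nat.lt_or_eq_of_le (Nat.succ_le_of_lt hk) with h | h
  · rwa [h2, Nat.mod_eq_of_lt h]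
  · have h' : k % L + 1 = L := h
    rw [h', hclosed] at h1
    rwa [h2, h', Nat.mod_self]

/-- In a chain transitive system with inverse shadowing, a tail of any orbit traces any given
pseudo-orbit. -/
theorem exists_tail_tracing {f : X → X} (hct : ChainTransitive f) {ε δ : ℝ} (hδ : 0 < δ)
    (h : ∀ x : X, ∀ φ : X → ℕ → X, IsPosMethod f δ φ →
      ∃ y : X, ∀ k : ℕ, dist (φ y k) (f^[k] x) < ε)
    {ξ : ℕ → X} (hξ : IsPosPseudoOrbit f δ ξ) (x : X) :
    ∃ m : ℕ, ∀ k : ℕ, dist (ξ k) (f^[m + k] x) < ε := by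
  choose M hM z hz0 hzM hz using fun y => hct y (ξ 0) δ hδ
  obtain ⟨y, hy⟩ := h x (fun y k => if k < M y then z y k else ξ (k - M y)) fun y =>
    ⟨by simp [Nat.lt_of_succ_le (hM y), hz0],
      hξ.concat (fun i hi => hz y i (by omega)) fun i hi => by
        have := hz y i (by omega)
        rwa [hi, hzM] at this⟩
  exact ⟨M y, fun k => by simpa using hy (M y + k)⟩

theorem stmt_11 (f : X → X) (hf : Continuous f) (hct : ChainTransitive f)
    (h : PosInverseShadowing f) : EquicontinuousSystem f := by
  intro x ε hε
  obtain ⟨δ, hδ, hsh⟩ := h (ε / 8) (by positivity)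
  obtain ⟨L, hL, w, hw0, hwL, hw⟩ := hct x x δ hδ
  obtain ⟨m₀, hm₀⟩ := exists_tail_tracing hct hδ hsh
    (isPosPseudoOrbit_periodic hL (hwL.trans hw0.symm) hw) x
  -- Every pseudo-orbit stays close to a phase shift of the periodic one.
  have key : ∀ ξ : ℕ → X, IsPosPseudoOrbit f δ ξ →
      ∃ m : ℕ, ∀ k : ℕ, dist (ξ k) (w ((m + k) % L)) < ε / 4 := by
    intro ξ hξ
    obtain ⟨m, hm⟩ := exists_tail_tracing hct hδ hsh hξ (f^[m₀] x)
    refine ⟨m, fun k => ?_⟩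
    have h1 := hm k
    rw [← Function.iterate_add_apply, add_comm] at h1
    have h2 := hm₀ (m + k)
    have h3 := dist_triangle_right (ξ k) (w ((m + k) % L)) (f^[m₀ + (m + k)] x)
    linarith
  -- Run once along the loop at `x`, then follow the orbit of a point `y` near `x`.
  have shift : ∀ y : X, dist (f (w (L - 1))) y < δ → ∃ m : ℕ, ∀ n : ℕ,
      dist (w (n % L)) (w ((m + n) % L)) < ε / 4 ∧
      dist (f^[n] y) (w ((m + n) % L)) < ε / 4 := by
    intro y hy
    obtain ⟨m, hm⟩ := key _ ((isPosPseudoOrbit_iterate f hδ y).concat (z := w) (m := L)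
      (fun i hi => hw i (by omega)) fun i hi => by
        obtain rfl : i = L - 1 := by omega
        exact hy)
    refine ⟨m, fun n => ⟨?_, ?_⟩⟩
    · simpa [Nat.mod_lt n hL] using hm (n % L)
    · simpa [← add_assoc] using hm (n + L)
  have hx : dist (f (w (L - 1))) x < δ := by
    have := hw (L - 1) (by omega)
    rwa [Nat.sub_add_cancel hL, hwL] at this
  refine ⟨δ - dist (f (w (L - 1))) x, sub_pos.2 hx, fun y hxy n => ?_⟩
  obtain ⟨m, hm⟩ := shift x hx
  obtain ⟨m', hm'⟩ := shift y (by linarith [dist_triangle (f (w (L - 1))) x y])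
  obtain ⟨a, b⟩ := hm n
  obtain ⟨a', b'⟩ := hm' n
  have h1 := dist_triangle4 (f^[n] x) (w ((m + n) % L)) (w (n % L)) (w ((m' + n) % L))
  have h2 := dist_triangle_right (f^[n] x) (f^[n] y) (w ((m' + n) % L))
  rw [dist_comm (w ((m + n) % L)) (w (n % L))] at h1
  linarith
end

section
/- Let (X,d) be a metric space and f : X → X a continuous map. Then f has finite positive 𝒯₀-inverse shadowing if and only if: for every ε > 0 there exists δ > 0 such that for every x ∈ X and every n ∈ ℕ there exists y_n ∈ X such that for every positive δ-method φ ∈ 𝒯₀(f,δ) and every k ∈ {0, 1, …, n}, d(f^k(x), φ(y_n)_k) < ε. -/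
variable {X : Type*} [MetricSpace X]

/-- `f` has finite positive `𝒯₀`-inverse shadowing. -/
def FinitePosInverseShadowing (f : X → X) : Prop :=
  ∀ ε > (0 : ℝ), ∃ δ > (0 : ℝ), ∀ x : X, ∀ φ : X → ℕ → X, IsPosMethod f δ φ →
    ∀ n : ℕ, ∃ y : X, ∀ k ≤ n, dist (f^[k] x) (φ y k) < ε

theorem stmt_13 (f : X → X) (hf : Continuous f) :
    FinitePosInverseShadowing f ↔
      ∀ ε > (0 : ℝ), ∃ δ > (0 : ℝ), ∀ x : X, ∀ n : ℕ, ∃ y : X,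
        ∀ φ : X → ℕ → X, IsPosMethod f δ φ →
          ∀ k ≤ n, dist (f^[k] x) (φ y k) < ε := by
  constructor
  · intro h ε hε
    obtain ⟨δ, hδ, hs⟩ := h ε hε
    refine ⟨δ, hδ, fun x n => ?_⟩
    by_contra! hbad
    choose φ hφ k hk hfar using hbad
    obtain ⟨y, hy⟩ := hs x (fun y => φ y y) (fun y => hφ y y) n
    exact (hy (k y) (hk y)).not_ge (hfar y)
  · intro h ε hε
    obtain ⟨δ, hδ, hs⟩ := h ε hε
    refine ⟨δ, hδ, fun x φ hφ n => ?_⟩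
    obtain ⟨y, hy⟩ := hs x n
    exact ⟨y, hy φ hφ⟩
end

section
/- Let (X,d) be a metric space and f : X → X a homeomorphism. Then f has finite 𝒯₀-inverse shadowing if and only if: for every ε > 0 there exists δ > 0 such that for every x ∈ X and every n ∈ ℕ there exists y_n ∈ X such that for every δ-method φ ∈ 𝒯₀(f,δ) and every k ∈ {-n, …, 0, …, n}, d(f^k(x), φ(y_n)_k) < ε. -/
variable {X : Type*} [MetricSpace X]

/-- `f` has finite `𝒯₀`-inverse shadowing. -/
def FiniteInverseShadowing (f : X ≃ X) : Prop :=
  ∀ ε > (0 : ℝ), ∃ δ > (0 : ℝ), ∀ x : X, ∀ φ : X → ℤ → X, IsMethod f δ φ →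
    ∀ n : ℕ, ∃ y : X, ∀ k : ℤ, -(n : ℤ) ≤ k → k ≤ (n : ℤ) →
      dist ((f ^ k) x) (φ y k) < ε

theorem stmt_14 (f : X ≃ X) (hf : Continuous f) (hf' : Continuous f.symm) :
    FiniteInverseShadowing f ↔
      ∀ ε > (0 : ℝ), ∃ δ > (0 : ℝ), ∀ x : X, ∀ n : ℕ, ∃ y : X,
        ∀ φ : X → ℤ → X, IsMethod f δ φ →
          ∀ k : ℤ, -(n : ℤ) ≤ k → k ≤ (n : ℤ) →
            dist ((f ^ k) x) (φ y k) < ε := by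
  constructor
  · intro h ε hε
    obtain ⟨δ, hδ, H⟩ := h ε hε
    refine ⟨δ, hδ, fun x n => ?_⟩
    by_contra! hbad
    choose φ hφ k hk₁ hk₂ hk using hbad
    obtain ⟨y, hy⟩ := H x (fun y => φ y y) (fun y => hφ y y) n
    exact (hk y).not_gt (hy (k y) (hk₁ y) (hk₂ y))
  · intro h ε hε
    obtain ⟨δ, hδ, H⟩ := h ε hε
    refine ⟨δ, hδ, fun x φ hφ n => ?_⟩
    obtain ⟨y, hy⟩ := H x n
    exact ⟨y, hy φ hφ⟩
end

section
/- Let (X,d) be a compact metric space and f : X → X a homeomorphism. Then f has finite 𝒯₀-inverse shadowing if and only if f has 𝒯₀-inverse shadowing. -/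
variable {X : Type*} [MetricSpace X]

/-- Replacing the orbit of `y` by that of a nearby point `c y`, except at time `0`, turns a
`δ / 2`-method into a `δ`-method. -/
lemma IsMethod.update_comp {f : X ≃ X} {δ : ℝ} {φ : X → ℤ → X} (hφ : IsMethod f (δ / 2) φ)
    (c : X → X) (hc : ∀ y, dist y (c y) < δ / 2) (hfc : ∀ y, dist (f y) (f (c y)) < δ / 2) :
    IsMethod f δ (fun y => Function.update (φ (c y)) 0 y) := by
  refine fun y => ⟨Function.update_self .., fun k => ?_⟩
  obtain ⟨h0, hstep⟩ := hφ (c y)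
  have hk := hstep k
  rcases eq_or_ne k 0 with rfl | hk0
  · have h := dist_triangle (f y) (f (c y)) (φ (c y) (0 + 1))
    rw [h0] at hk
    simp only [Function.update_self, zero_add, ne_eq, one_ne_zero, not_false_eq_true,
      Function.update_of_ne] at h hk ⊢
    linarith [hfc y]
  · rcases eq_or_ne (k + 1) 0 with hk1 | hk1
    · rw [hk1, h0] at hk
      have h := dist_triangle_right (f (φ (c y) k)) y (c y)
      simp only [hk1, Function.update_self, Function.update_of_ne hk0]
      linarith [hc y]
    · simp only [Function.update_of_ne hk0, Function.update_of_ne hk1]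
      linarith [dist_nonneg (x := f (φ (c y) k)) (y := φ (c y) (k + 1))]

lemma InverseShadowing.finiteInverseShadowing {f : X ≃ X} (h : InverseShadowing f) :
    FiniteInverseShadowing f := by
  intro ε hε
  obtain ⟨δ, hδ, H⟩ := h ε hε
  refine ⟨δ, hδ, fun x φ hφ n => ?_⟩
  obtain ⟨y, hy⟩ := H x φ hφ
  exact ⟨y, fun k _ _ => dist_comm (φ y k) _ ▸ hy k⟩

lemma FiniteInverseShadowing.inverseShadowing [CompactSpace X] {f : X ≃ X} (hf : Continuous f)
    (h : FiniteInverseShadowing f) : InverseShadowing f := by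
  intro ε hε
  obtain ⟨δ, hδ, H⟩ := h (ε / 2) (half_pos hε)
  refine ⟨δ / 2, half_pos hδ, fun x φ hφ => ?_⟩
  by_contra! hfar
  choose K hK using hfar
  obtain ⟨η, hη, hfη⟩ := Metric.uniformContinuous_iff.1
    (CompactSpace.uniformContinuous_of_continuous hf) (δ / 2) (half_pos hδ)
  obtain ⟨t, -, htfin, ht⟩ := finite_cover_balls_of_compact (isCompact_univ (X := X))
    (lt_min hη (lt_min (half_pos hδ) (half_pos hε)))
  have hnet : ∀ y : X, ∃ z ∈ t, dist y z < min η (min (δ / 2) (ε / 2)) := fun y => by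
    obtain ⟨z, hz, hyz⟩ := Set.mem_iUnion₂.1 (ht (Set.mem_univ y))
    exact ⟨z, hz, hyz⟩
  choose c hct hc using hnet
  simp only [lt_min_iff] at hc
  obtain ⟨y, hy⟩ := H x _ (hφ.update_comp c (fun y => (hc y).2.1) fun y => hfη (hc y).1)
    (htfin.toFinset.sup fun z => (K z).natAbs)
  have hbound : (K (c y)).natAbs ≤ htfin.toFinset.sup fun z => (K z).natAbs :=
    Finset.le_sup (f := fun z => (K z).natAbs) (htfin.mem_toFinset.2 (hct y))
  have hclose := hy (K (c y)) (by omega) (by omega)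
  have hKc := hK (c y)
  rcases eq_or_ne (K (c y)) 0 with h0 | h0
  · rw [h0, (hφ (c y)).1] at hKc
    simp only [h0, Function.update_self] at hclose
    rw [dist_comm] at hclose
    linarith [dist_triangle_left (c y) ((f ^ (0 : ℤ)) x) y, (hc y).2.2]
  · rw [Function.update_of_ne h0, dist_comm] at hclose
    linarith

theorem stmt_15 [CompactSpace X] (f : X ≃ X) (hf : Continuous f)
    (hf' : Continuous f.symm) :
    FiniteInverseShadowing f ↔ InverseShadowing f := by
  exact ⟨fun h => h.inverseShadowing hf, fun h => h.finiteInverseShadowing⟩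
end

section
/- Let (X,d) be a compact metric space and f : X → X a homeomorphism. Then f has finite 𝒯_c-inverse shadowing if and only if f has 𝒯_c-inverse shadowing. -/
variable {X : Type*} [MetricSpace X]

/-- `φ` is a continuous `δ`-method for `f`, i.e. a member of `𝒯_c(f, δ)`:
a `δ`-method which is continuous as a map into `X^ℤ` with the product topology. -/
def IsCMethod (f : X ≃ X) (δ : ℝ) (φ : X → ℤ → X) : Prop :=
  IsMethod f δ φ ∧ Continuous φ

/-- `f` has `𝒯_c`-inverse shadowing. -/
def CInverseShadowing (f : X ≃ X) : Prop :=
  ∀ ε > (0 : ℝ), ∃ δ > (0 : ℝ), ∀ x : X, ∀ φ : X → ℤ → X, IsCMethod f δ φ →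
    ∃ y : X, ∀ k : ℤ, dist (φ y k) ((f ^ k) x) < ε

/-- `f` has finite `𝒯_c`-inverse shadowing. -/
def FiniteCInverseShadowing (f : X ≃ X) : Prop :=
  ∀ ε > (0 : ℝ), ∃ δ > (0 : ℝ), ∀ x : X, ∀ φ : X → ℤ → X, IsCMethod f δ φ →
    ∀ n : ℕ, ∃ y : X, ∀ k : ℤ, -(n : ℤ) ≤ k → k ≤ (n : ℤ) →
      dist ((f ^ k) x) (φ y k) < ε

/-- In a compact space, a continuous family of sequences that traces a given sequence within `ε` on
every symmetric window `[-n, n]` has a single member tracing it within `ε` everywhere. -/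
theorem exists_forall_dist_le_of_forall_window [CompactSpace X] {φ : X → ℤ → X}
    (hφ : Continuous φ) (u : ℤ → X) (ε : ℝ)
    (h : ∀ n : ℕ, ∃ y : X, ∀ k : ℤ, -(n : ℤ) ≤ k → k ≤ (n : ℤ) → dist (u k) (φ y k) ≤ ε) :
    ∃ y : X, ∀ k : ℤ, dist (u k) (φ y k) ≤ ε := by
  let S : ℕ → Set X := fun n =>
    {y | ∀ k : ℤ, -(n : ℤ) ≤ k → k ≤ (n : ℤ) → dist (u k) (φ y k) ≤ ε}
  have hclosed : ∀ n, IsClosed (S n) := fun n => by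
    simp only [S, Set.ofPred_forall]
    exact isClosed_iInter fun k => isClosed_iInter fun _ => isClosed_iInter fun _ =>
      isClosed_le (continuous_const.dist ((continuous_apply k).comp hφ)) continuous_const
  have hmono : ∀ n, S (n + 1) ⊆ S n := fun n y hy k hk hk' => hy k (by lia) (by lia)
  obtain ⟨y, hy⟩ := IsCompact.nonempty_iInter_of_sequence_nonempty_isCompact_isClosed S hmono h
    (hclosed 0).isCompact hclosed
  exact ⟨y, fun k => Set.mem_iInter.1 hy k.natAbs k (by lia) (by lia)⟩

theorem stmt_16 [CompactSpace X] (f : X ≃ X) (hf : Continuous f)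
    (hf' : Continuous f.symm) :
    FiniteCInverseShadowing f ↔ CInverseShadowing f := by
  refine ⟨fun h ε hε => ?_, fun h ε hε => ?_⟩
  · obtain ⟨δ, hδ, H⟩ := h (ε / 2) (half_pos hε)
    refine ⟨δ, hδ, fun x φ hφ => ?_⟩
    obtain ⟨y, hy⟩ := exists_forall_dist_le_of_forall_window hφ.2 (fun k => (f ^ k) x) (ε / 2)
      fun n => (H x φ hφ n).imp fun y hy k hk hk' => (hy k hk hk').le
    exact ⟨y, fun k => by rw [dist_comm]; exact (hy k).trans_lt (half_lt_self hε)⟩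
  · obtain ⟨δ, hδ, H⟩ := h ε hε
    exact ⟨δ, hδ, fun x φ hφ n => (H x φ hφ).imp fun y hy k _ _ => by
      rw [dist_comm]; exact hy k⟩
end

section
/- Let (X,d) be a compact metric space and f : X → X a homeomorphism. Then f has finite 𝒯_h-inverse shadowing if and only if f has 𝒯_h-inverse shadowing. -/
variable {X : Type*} [MetricSpace X]

/-- `φ` is a `δ`-method for `f` induced by a homeomorphism, i.e. a member of
`𝒯_h(f, δ)`: there is a homeomorphism `h` of `X` which `δ`-approximates `f` and
whose orbits give the pseudo-orbits of `φ`. -/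
def IsHMethod (f : X ≃ X) (δ : ℝ) (φ : X → ℤ → X) : Prop :=
  ∃ h : X ≃ X, Continuous h ∧ Continuous h.symm ∧
    (∀ x : X, dist (f x) (h x) < δ) ∧ ∀ x : X, ∀ k : ℤ, φ x k = (h ^ k) x

/-- `f` has `𝒯_h`-inverse shadowing. -/
def HInverseShadowing (f : X ≃ X) : Prop :=
  ∀ ε > (0 : ℝ), ∃ δ > (0 : ℝ), ∀ x : X, ∀ φ : X → ℤ → X, IsHMethod f δ φ →
    ∃ y : X, ∀ k : ℤ, dist (φ y k) ((f ^ k) x) < ε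

/-- `f` has finite `𝒯_h`-inverse shadowing. -/
def FiniteHInverseShadowing (f : X ≃ X) : Prop :=
  ∀ ε > (0 : ℝ), ∃ δ > (0 : ℝ), ∀ x : X, ∀ φ : X → ℤ → X, IsHMethod f δ φ →
    ∀ n : ℕ, ∃ y : X, ∀ k : ℤ, -(n : ℤ) ≤ k → k ≤ (n : ℤ) →
      dist ((f ^ k) x) (φ y k) < ε

/-- Integer powers of a permutation that is a homeomorphism are continuous. -/
theorem Equiv.Perm.continuous_zpow {Y : Type*} [TopologicalSpace Y] (h : Equiv.Perm Y)
    (hc : Continuous h) (hc' : Continuous h.symm) (k : ℤ) :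
    Continuous (h ^ k : Equiv.Perm Y) := by
  cases k with
  | ofNat n =>
    rw [Int.ofNat_eq_natCast, zpow_natCast, Equiv.Perm.coe_pow]
    exact hc.iterate n
  | negSucc n =>
    rw [zpow_negSucc, ← inv_pow, Equiv.Perm.coe_pow]
    exact hc'.iterate (n + 1)

theorem stmt_17 [CompactSpace X] (f : X ≃ X) (hf : Continuous f)
    (hf' : Continuous f.symm) :
    FiniteHInverseShadowing f ↔ HInverseShadowing f := by
  constructor
  · intro H ε hε
    obtain ⟨δ, hδ, hH⟩ := H (ε / 2) (half_pos hε)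
    refine ⟨δ, hδ, fun x φ hφ => ?_⟩
    have hcont : ∀ k : ℤ, Continuous fun y => φ y k := by
      obtain ⟨h, hc, hc', -, hk⟩ := hφ
      intro k
      simp only [hk]
      exact Equiv.Perm.continuous_zpow h hc hc' k
    let K : ℕ → Set X := fun n =>
      {y | ∀ k : ℤ, -(n : ℤ) ≤ k → k ≤ (n : ℤ) → dist ((f ^ k) x) (φ y k) ≤ ε / 2}
    have hclosed : ∀ n, IsClosed (K n) := by
      intro n
      simp only [K, Set.ofPred_forall]
      exact isClosed_iInter fun k => isClosed_iInter fun _ => isClosed_iInter fun _ =>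
        isClosed_le (continuous_const.dist (hcont k)) continuous_const
    obtain ⟨y, hy⟩ := IsCompact.nonempty_iInter_of_sequence_nonempty_isCompact_isClosed K
      (fun n y hy k h1 h2 => hy k (by push_cast; omega) (by push_cast; omega))
      (fun n => (hH x φ hφ n).imp fun y hy k h1 h2 => (hy k h1 h2).le)
      (hclosed 0).isCompact hclosed
    refine ⟨y, fun k => ?_⟩
    have hk := Set.mem_iInter.1 hy k.natAbs k (by omega) (by omega)
    rw [dist_comm]
    exact hk.trans_lt (half_lt_self hε)
  · intro H ε hε
    obtain ⟨δ, hδ, hH⟩ := H ε hε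
    refine ⟨δ, hδ, fun x φ hφ n => ?_⟩
    obtain ⟨y, hy⟩ := hH x φ hφ
    exact ⟨y, fun k _ _ => by rw [dist_comm]; exact hy k⟩
end

section
/- Let (X,d) be a compact metric space and f : X → X a continuous map. Then f has finite positive 𝒯₀-inverse shadowing if and only if f has positive 𝒯₀-inverse shadowing. -/
variable {X : Type*} [MetricSpace X]

/-- Two nearby initial points can share the tail of a pseudo-orbit, so the initial points of a method
can be moved to a nearby finite set. -/
theorem IsPosMethod.replace_initial {f : X → X} {δ η : ℝ} {φ : X → ℕ → X} {c : X → X}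
    (hφ : IsPosMethod f (δ / 2) φ) (hδ : 0 < δ) (hc : ∀ y, dist y (c y) < η)
    (hη : ∀ ⦃a b : X⦄, dist a b < η → dist (f a) (f b) < δ / 2) :
    IsPosMethod f δ (fun y k => if k = 0 then y else φ (c y) k) := by
  intro y
  refine ⟨by simp, fun k => ?_⟩
  have h := (hφ (c y)).2 k
  rcases Nat.eq_zero_or_pos k with rfl | hk
  · rw [(hφ (c y)).1] at h
    have h₁ := hη (hc y)
    have h₂ := dist_triangle (f y) (f (c y)) (φ (c y) (0 + 1))
    simp only [if_true, Nat.add_eq_zero_iff, one_ne_zero, and_false, if_false]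
    linarith
  · simp only [hk.ne', Nat.add_eq_zero_iff, one_ne_zero, and_false, if_false]
    linarith

theorem stmt_18 [CompactSpace X] (f : X → X) (hf : Continuous f) :
    FinitePosInverseShadowing f ↔ PosInverseShadowing f := by
  constructor
  · intro h ε hε
    obtain ⟨δ, hδ, H⟩ := h (ε / 2) (half_pos hε)
    obtain ⟨η₀, hη₀, hu⟩ := Metric.uniformContinuous_iff.1
      (CompactSpace.uniformContinuous_of_continuous hf) (δ / 2) (half_pos hδ)
    obtain ⟨t, -, htf, ht⟩ := finite_cover_balls_of_compact (isCompact_univ (X := X))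
      (lt_min hη₀ (half_pos hε))
    have hcov : ∀ y : X, ∃ p ∈ t, dist y p < min η₀ (ε / 2) := fun y => by
      simpa only [Set.mem_iUnion₂, Metric.mem_ball, exists_prop] using ht (Set.mem_univ y)
    choose c hct hc using hcov
    refine ⟨δ / 2, half_pos hδ, fun x φ hφ => ?_⟩
    by_contra! hcon
    choose k hk using hcon
    have hψ := hφ.replace_initial hδ hc fun a b hab => hu (hab.trans_le (min_le_left _ _))
    obtain ⟨y, hy⟩ := H x _ hψ (htf.toFinset.sup k)
    have hle : k (c y) ≤ htf.toFinset.sup k := Finset.le_sup (htf.mem_toFinset.2 (hct y))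
    have h₁ := hy _ hle
    have h₂ := hk (c y)
    rcases Nat.eq_zero_or_pos (k (c y)) with h0 | hpos
    · rw [h0] at h₁ h₂
      rw [(hφ (c y)).1] at h₂
      simp only [if_true, Function.iterate_zero, id] at h₁ h₂
      have h₃ := (hc y).trans_le (min_le_right _ _)
      have h₄ := dist_triangle (c y) y x
      rw [dist_comm] at h₁ h₃
      linarith
    · rw [if_neg hpos.ne', dist_comm] at h₁
      linarith
  · intro h ε hε
    obtain ⟨δ, hδ, H⟩ := h ε hε
    refine ⟨δ, hδ, fun x φ hφ n => ?_⟩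
    obtain ⟨y, hy⟩ := H x φ hφ
    exact ⟨y, fun k _ => by rw [dist_comm]; exact hy k⟩
end

section
/- Let (X,d) be a compact metric space and f : X → X a continuous map. Then f has finite positive 𝒯_c-inverse shadowing if and only if f has positive 𝒯_c-inverse shadowing. -/
variable {X : Type*} [MetricSpace X]

/-- `φ` is a continuous positive `δ`-method for `f`, i.e. a member of `𝒯_c(f, δ)`:
a positive `δ`-method which is continuous as a map into `X^ω` with the product
topology. -/
def IsPosCMethod (f : X → X) (δ : ℝ) (φ : X → ℕ → X) : Prop :=
  IsPosMethod f δ φ ∧ Continuous φ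

/-- `f` has positive `𝒯_c`-inverse shadowing. -/
def PosCInverseShadowing (f : X → X) : Prop :=
  ∀ ε > (0 : ℝ), ∃ δ > (0 : ℝ), ∀ x : X, ∀ φ : X → ℕ → X, IsPosCMethod f δ φ →
    ∃ y : X, ∀ k : ℕ, dist (φ y k) (f^[k] x) < ε

/-- `f` has finite positive `𝒯_c`-inverse shadowing. -/
def FinitePosCInverseShadowing (f : X → X) : Prop :=
  ∀ ε > (0 : ℝ), ∃ δ > (0 : ℝ), ∀ x : X, ∀ φ : X → ℕ → X, IsPosCMethod f δ φ →
    ∀ n : ℕ, ∃ y : X, ∀ k ≤ n, dist (f^[k] x) (φ y k) < ε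

theorem stmt_19 [CompactSpace X] (f : X → X) (hf : Continuous f) :
    FinitePosCInverseShadowing f ↔ PosCInverseShadowing f := by
  constructor
  · intro h ε hε
    obtain ⟨δ, hδ, hδ'⟩ := h (ε / 2) (half_pos hε)
    refine ⟨δ, hδ, fun x φ hφ => ?_⟩
    let t : ℕ → Set X := fun n => {y | ∀ k ≤ n, dist (f^[k] x) (φ y k) ≤ ε / 2}
    have htcl : ∀ n, IsClosed (t n) := by
      intro n
      simp only [t, Set.ofPred_forall]
      exact isClosed_iInter fun k => isClosed_iInter fun _ =>
        isClosed_le (continuous_const.dist ((continuous_apply k).comp hφ.2)) continuous_const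
    obtain ⟨y, hy⟩ := IsCompact.nonempty_iInter_of_sequence_nonempty_isCompact_isClosed t
      (fun n y hy k hk => hy k (hk.trans n.le_succ))
      (fun n => (hδ' x φ hφ n).imp fun y hy k hk => (hy k hk).le)
      (htcl 0).isCompact htcl
    refine ⟨y, fun k => ?_⟩
    rw [dist_comm]
    exact (Set.mem_iInter.1 hy k k le_rfl).trans_lt (half_lt_self hε)
  · intro h ε hε
    obtain ⟨δ, hδ, hδ'⟩ := h ε hε
    refine ⟨δ, hδ, fun x φ hφ _ => (hδ' x φ hφ).imp fun y hy k _ => ?_⟩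
    rw [dist_comm]
    exact hy k
end
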